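/- Let S be an infinite set of monic polynomials in R = 𝔽_q[x]. Then for every dimension m ∈ ℕ, every n ∈ ℕ, every N ∈ R with deg N = n, and every Q ∈ S, the uniform probability that a ∈ R_{<n}^m satisfies Q_{N,S}(a) = Q equals ν_m({α ∈ 𝔪^m : Q_{min,S}(α, q^{−n}) = Q}). -/

import Mathlib

open Polynomial MeasureTheory
open scoped Classical ENNReal NNReal

/- Setting: `Fq` is a finite field with `q` elements (`q` a prime power),
`R = Fq[x]`, and `K_∞ = Fq((x⁻¹))` is realized as the field `LaurentSeries Fq`
of formal Laurent series in the variable `u = x⁻¹`. -/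

variable (Fq : Type) [Field Fq] [Fintype Fq] [DecidableEq Fq]

/-- `K_∞ = 𝔽_q((x⁻¹))`, realized as Laurent series in the variable `u = x⁻¹`. -/
abbrev Kinf := LaurentSeries Fq

/-- The embedding of `R = 𝔽_q[x]` into `K_∞`, sending `x` to `u⁻¹`. -/
noncomputable def emb : Polynomial Fq →+* Kinf Fq :=
  (Polynomial.aeval ((HahnSeries.single (-1 : ℤ) (1 : Fq)) : LaurentSeries Fq)).toRingHom

/-- `q`, as a nonnegative real number. -/
noncomputable def qc : NNReal := (Fintype.card Fq : NNReal)

/-- The absolute value `|α| = q^{-ord(α)}` on `K_∞` (so that `|f| = q^{deg f}` for a nonzero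
polynomial `f ∈ 𝔽_q[x]`, since `f(u⁻¹)` has order `-deg f` as a Laurent series in `u`). -/
noncomputable def fabs (α : Kinf Fq) : NNReal :=
  if α = 0 then 0 else (qc Fq) ^ (-(HahnSeries.order α))

/-- The sup norm `‖v‖ = max_i |v_i|` on `K_∞^m`. -/
noncomputable def vnorm {m : ℕ} (v : Fin m → Kinf Fq) : NNReal :=
  Finset.univ.sup fun i => fabs Fq (v i)

/-- The maximal ideal `𝔪 = {α ∈ K_∞ : |α| ≤ q⁻¹}`. -/
noncomputable def mfrak : Set (Kinf Fq) := {α | fabs Fq α ≤ (qc Fq)⁻¹}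

/-- `𝔪^m ⊆ K_∞^m`. -/
noncomputable def mfrakV (m : ℕ) : Set (Fin m → Kinf Fq) := {α | ∀ i, α i ∈ mfrak Fq}

/-- `(P, Q)` is a primitive vector of `R^{m+1}`, i.e. `gcd(P₁, …, P_m, Q) = 1`:
every common divisor is a unit. -/
def Primitive {m : ℕ} (P : Fin m → Polynomial Fq) (Q : Polynomial Fq) : Prop :=
  ∀ d : Polynomial Fq, d ∣ Q → (∀ i, d ∣ P i) → IsUnit d

/-- The point `P/Q ∈ K_∞^m` determined by `P ∈ R^m` and `Q ∈ R`. -/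
noncomputable def ratV {m : ℕ} (P : Fin m → Polynomial Fq) (Q : Polynomial Fq) :
    Fin m → Kinf Fq := fun i => emb Fq (P i) / emb Fq Q

/-- `deg_{min,S}(α, q^{-n})`: the least `d` such that there is `(P,Q) ∈ R̂^{m+1}` with
`Q ∈ S`, `deg Q = d`, `‖P‖ < |Q|` and `‖α - P/Q‖ < q^{-n}`. -/
noncomputable def degMin (S : Set (Polynomial Fq)) (m n : ℕ) (α : Fin m → Kinf Fq) : ℕ :=
  sInf {d : ℕ | ∃ (P : Fin m → Polynomial Fq) (Q : Polynomial Fq),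
    Q ∈ S ∧ Q.natDegree = d ∧ Primitive Fq P Q ∧
    vnorm Fq (ratV Fq P 1) < fabs Fq (emb Fq Q) ∧
    vnorm Fq (α - ratV Fq P Q) < (qc Fq) ^ (-(n : ℤ))}

/-- `m_S(n) = min {k ≥ n : S ∩ R_{=k} ≠ ∅}`. -/
noncomputable def mS (S : Set (Polynomial Fq)) (n : ℕ) : ℕ :=
  sInf {k : ℕ | n ≤ k ∧ ∃ Q ∈ S, Q.natDegree = k}

/-- `d_{N,S}(a) = deg_{min,S}(a/N, q^{-deg N})`. -/
noncomputable def dN (S : Set (Polynomial Fq)) (m : ℕ) (N : Polynomial Fq)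
    (a : Fin m → Polynomial Fq) : ℕ :=
  degMin Fq S m N.natDegree (ratV Fq a N)

/-- `R_{<n}^m`, the set of vectors of polynomials of degree `< n`. -/
def polyVecLT (m n : ℕ) : Set (Fin m → Polynomial Fq) :=
  {a | ∀ i, (a i).degree < (n : ℕ)}

/-- The `S`-Farey fractions of degree at most `k` in `K_∞^m` (the zero vector is
included, as the fraction `0/1`). -/
noncomputable def Farey (S : Set (Polynomial Fq)) (m k : ℕ) : Set (Fin m → Kinf Fq) :=
  {x | ∃ (P : Fin m → Polynomial Fq) (Q : Polynomial Fq), Q ∈ S ∧ Primitive Fq P Q ∧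
    vnorm Fq (ratV Fq P 1) < fabs Fq (emb Fq Q) ∧ Q.natDegree ≤ k ∧ x = ratV Fq P Q}

/-- The (closed) ball `B(v, r) = {u ∈ K_∞^m : ‖v - u‖ ≤ r}`. -/
noncomputable def ball {m : ℕ} (v : Fin m → Kinf Fq) (r : NNReal) : Set (Fin m → Kinf Fq) :=
  {u | vnorm Fq (v - u) ≤ r}

/-- `Q` is the (unique monic) `S`-minimal denominator for `(α, q^{-n})`, i.e.
`Q_{min,S}(α, q^{-n}) = Q`: `Q ∈ S`, `deg Q = deg_{min,S}(α, q^{-n})`, and there is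
`P ∈ R^m` with `(P,Q) ∈ R̂^{m+1}` and `‖α - P/Q‖ < q^{-n}`. -/
noncomputable def IsMinDenom (S : Set (Polynomial Fq)) (m n : ℕ) (α : Fin m → Kinf Fq)
    (Q : Polynomial Fq) : Prop :=
  Q ∈ S ∧ Q.natDegree = degMin Fq S m n α ∧
    ∃ P : Fin m → Polynomial Fq, Primitive Fq P Q ∧
      vnorm Fq (α - ratV Fq P Q) < (qc Fq) ^ (-(n : ℤ))

section Ultrametric

variable {Fq}

omit [DecidableEq Fq] in
lemma one_lt_qc : 1 < qc Fq := by
  unfold qc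
  exact_mod_cast Fintype.one_lt_card

/-- The additive subgroup of `K_∞` of elements of order greater than `k`. -/
def smallBall (Fq : Type) [Field Fq] (k : ℤ) : AddSubgroup (Kinf Fq) where
  carrier := {x | ∀ i ≤ k, x.coeff i = 0}
  zero_mem' := fun i _ => by simp
  add_mem' := fun {x y} hx hy i hi => by simp [hx i hi, hy i hi]
  neg_mem' := fun {x} hx i hi => by simp [hx i hi]

omit [Fintype Fq] [DecidableEq Fq] in
lemma mem_smallBall {k : ℤ} {x : Kinf Fq} :
    x ∈ smallBall Fq k ↔ ∀ i ≤ k, x.coeff i = 0 := Iff.rfl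

omit [Fintype Fq] [DecidableEq Fq] in
lemma mem_smallBall_iff_order {k : ℤ} {x : Kinf Fq} (hx : x ≠ 0) :
    x ∈ smallBall Fq k ↔ k < x.order := by
  rw [mem_smallBall, ← Int.add_one_le_iff, HahnSeries.le_order_iff_forall hx]
  simp only [Int.lt_add_one_iff]

omit [DecidableEq Fq] in
lemma fabs_lt_iff {k : ℤ} {x : Kinf Fq} :
    fabs Fq x < qc Fq ^ (-k) ↔ x ∈ smallBall Fq k := by
  unfold fabs
  split_ifs with h
  · simp only [h, zero_mem, iff_true]
    exact zpow_pos (zero_lt_one.trans one_lt_qc) _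
  · rw [mem_smallBall_iff_order h, zpow_lt_zpow_iff_right₀ one_lt_qc, neg_lt_neg_iff]

omit [DecidableEq Fq] in
lemma mem_mfrak_iff {x : Kinf Fq} : x ∈ mfrak Fq ↔ x ∈ smallBall Fq 0 := by
  have hq := one_lt_qc (Fq := Fq)
  unfold mfrak fabs
  by_cases h : x = 0
  · simp [h]
  · rw [mem_smallBall_iff_order h, Set.mem_ofPred_eq, if_neg h, ← zpow_neg_one,
      zpow_le_zpow_iff_right₀ hq, neg_le_neg_iff, ← Int.add_one_le_iff, zero_add]

omit [DecidableEq Fq] in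
lemma vnorm_lt_iff {m : ℕ} {k : ℤ} {v : Fin m → Kinf Fq} :
    vnorm Fq v < qc Fq ^ (-k) ↔ ∀ i, v i ∈ smallBall Fq k := by
  unfold vnorm
  rw [Finset.sup_lt_iff (zpow_pos (zero_lt_one.trans one_lt_qc) _)]
  simp only [Finset.mem_univ, true_imp_iff, fabs_lt_iff]

omit [DecidableEq Fq] in
lemma isMinDenom_congr {S : Set (Polynomial Fq)} {m n : ℕ} {α β : Fin m → Kinf Fq}
    {Q : Polynomial Fq} (h : ∀ i, α i - β i ∈ smallBall Fq n) :
    IsMinDenom Fq S m n α Q ↔ IsMinDenom Fq S m n β Q := by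
  have key (γ : Fin m → Kinf Fq) :
      vnorm Fq (α - γ) < qc Fq ^ (-(n : ℤ)) ↔ vnorm Fq (β - γ) < qc Fq ^ (-(n : ℤ)) := by
    simp only [vnorm_lt_iff, Pi.sub_apply]
    refine forall_congr' fun i => ?_
    rw [← sub_add_sub_cancel (α i) (β i) (γ i), AddSubgroup.add_mem_cancel_left _ (h i)]
  simp only [IsMinDenom, degMin, key]

end Ultrametric

section Polynomials

variable {Fq}

omit [Fintype Fq] [DecidableEq Fq] in
lemma emb_apply (p : Polynomial Fq) :
    emb Fq p = p.sum fun k c => HahnSeries.single (-(k : ℤ)) c := by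
  change Polynomial.aeval (HahnSeries.single (-1 : ℤ) (1 : Fq)) p = _
  rw [Polynomial.aeval_eq_sum_range, Polynomial.sum_over_range _ (by simp)]
  refine Finset.sum_congr rfl fun k _ => ?_
  rw [HahnSeries.single_pow, Algebra.smul_def]
  simp [LaurentSeries.algebraMap_apply, HahnSeries.C_apply]

omit [Fintype Fq] [DecidableEq Fq] in
lemma coeff_emb (p : Polynomial Fq) (k : ℕ) : (emb Fq p).coeff (-(k : ℤ)) = p.coeff k := by
  rw [emb_apply, Polynomial.sum_def, HahnSeries.coeff_sum]
  simp +contextual [HahnSeries.coeff_single]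

omit [Fintype Fq] [DecidableEq Fq] in
lemma emb_mem_smallBall_neg {p : Polynomial Fq} {k : ℕ} :
    emb Fq p ∈ smallBall Fq (-(k : ℤ)) ↔ p.degree < k := by
  rw [mem_smallBall, Polynomial.degree_lt_iff_coeff_zero]
  constructor
  · intro h j hj
    rw [← coeff_emb]
    exact h _ (by omega)
  · intro h i hi
    obtain ⟨j, rfl⟩ : ∃ j : ℕ, i = -(j : ℤ) := ⟨(-i).toNat, by omega⟩
    rw [coeff_emb]
    exact h _ (by omega)

omit [Fintype Fq] [DecidableEq Fq] in
lemma emb_mem_smallBall_zero {p : Polynomial Fq} : emb Fq p ∈ smallBall Fq 0 ↔ p = 0 := by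
  have := emb_mem_smallBall_neg (p := p) (k := 0)
  simpa using this

omit [Fintype Fq] [DecidableEq Fq] in
lemma emb_ne_zero {p : Polynomial Fq} (hp : p ≠ 0) : emb Fq p ≠ 0 := fun h =>
  hp (emb_mem_smallBall_zero.1 (h ▸ zero_mem _))

omit [Fintype Fq] [DecidableEq Fq] in
lemma order_emb {p : Polynomial Fq} {n : ℕ} (hp : p.degree = n) :
    (emb Fq p).order = -(n : ℤ) := by
  have h0 : emb Fq p ≠ 0 := emb_ne_zero (by rintro rfl; simp at hp)
  have h1 := (emb_mem_smallBall_neg (p := p) (k := n + 1)).2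
    (by rw [hp]; exact_mod_cast Nat.lt_succ_self n)
  have h2 := mt (emb_mem_smallBall_neg (p := p) (k := n)).1 (by rw [hp]; exact lt_irrefl _)
  rw [mem_smallBall_iff_order h0] at h1 h2
  push_cast at h1
  omega

omit [Fintype Fq] [DecidableEq Fq] in
lemma mul_emb_mem_smallBall {N : Polynomial Fq} {n : ℕ} (hN : N.degree = n) {k : ℤ}
    {x : Kinf Fq} : x * emb Fq N ∈ smallBall Fq (k - n) ↔ x ∈ smallBall Fq k := by
  have h0 : emb Fq N ≠ 0 := emb_ne_zero (by rintro rfl; simp at hN)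
  by_cases hx : x = 0
  · simp [hx, zero_mem]
  · rw [mem_smallBall_iff_order hx, mem_smallBall_iff_order (mul_ne_zero hx h0),
      HahnSeries.order_mul hx h0, order_emb hN]
    omega

omit [Fintype Fq] [DecidableEq Fq] in
lemma exists_sub_emb_mem_smallBall (x : Kinf Fq) :
    ∃ p : Polynomial Fq, x - emb Fq p ∈ smallBall Fq 0 := by
  refine ⟨∑ k ∈ Finset.range ((-x.order).toNat + 1),
    Polynomial.monomial k (x.coeff (-(k : ℤ))), fun i hi => ?_⟩
  obtain ⟨j, rfl⟩ : ∃ j : ℕ, i = -(j : ℤ) := ⟨(-i).toNat, by omega⟩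
  rw [HahnSeries.coeff_sub, coeff_emb, Polynomial.finsetSum_coeff]
  simp only [Polynomial.coeff_monomial, Finset.sum_ite_eq', Finset.mem_range]
  split_ifs with h
  · exact sub_self _
  · rw [sub_zero]
    exact HahnSeries.coeff_eq_zero_of_lt_order (by omega)

/-- The translate of `smallBall Fq n` centred at `p / N`. -/
def fracCell (N : Polynomial Fq) (n : ℕ) (p : Polynomial Fq) : Set (Kinf Fq) :=
  {x | x - emb Fq p / emb Fq N ∈ smallBall Fq n}

omit [Fintype Fq] [DecidableEq Fq] in
lemma mem_fracCell {N : Polynomial Fq} {n : ℕ} (hN : N.degree = n) {p : Polynomial Fq}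
    {x : Kinf Fq} : x ∈ fracCell N n p ↔ x * emb Fq N - emb Fq p ∈ smallBall Fq 0 := by
  have h0 : emb Fq N ≠ 0 := emb_ne_zero (by rintro rfl; simp at hN)
  change x - _ ∈ smallBall Fq n ↔ _
  rw [← mul_emb_mem_smallBall hN, sub_mul, div_mul_cancel₀ _ h0, sub_self]

omit [Fintype Fq] [DecidableEq Fq] in
lemma exists_mem_fracCell {N : Polynomial Fq} {n : ℕ} (hN : N.degree = n) (x : Kinf Fq) :
    ∃ p, x ∈ fracCell N n p := by
  simp only [mem_fracCell hN]
  exact exists_sub_emb_mem_smallBall _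

omit [Fintype Fq] [DecidableEq Fq] in
lemma eq_of_mem_fracCell {N : Polynomial Fq} {n : ℕ} (hN : N.degree = n)
    {p p' : Polynomial Fq} {x : Kinf Fq} (h : x ∈ fracCell N n p) (h' : x ∈ fracCell N n p') :
    p = p' := by
  rw [mem_fracCell hN] at h h'
  rw [← sub_eq_zero, ← emb_mem_smallBall_zero, map_sub]
  simpa using sub_mem h' h

omit [DecidableEq Fq] in
lemma mem_mfrak_iff_degree_lt {N : Polynomial Fq} {n : ℕ} (hN : N.degree = n)
    {p : Polynomial Fq} {x : Kinf Fq} (h : x ∈ fracCell N n p) :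
    x ∈ mfrak Fq ↔ p.degree < n := by
  rw [mem_fracCell hN] at h
  have h' : x * emb Fq N - emb Fq p ∈ smallBall Fq (-(n : ℤ)) :=
    fun i hi => h i (by omega)
  rw [mem_mfrak_iff, ← emb_mem_smallBall_neg, ← mul_emb_mem_smallBall hN, zero_sub,
    ← sub_add_cancel (x * emb Fq N) (emb Fq p), AddSubgroup.add_mem_cancel_left _ h']

omit [DecidableEq Fq] in
lemma finite_degree_lt (n : ℕ) : {p : Polynomial Fq | p.degree < n}.Finite := by
  have : Finite (Polynomial.degreeLT Fq n) := .of_equiv _ (degreeLTEquiv Fq n).symm.toEquiv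
  exact (Set.toFinite (Polynomial.degreeLT Fq n : Set (Polynomial Fq))).subset
    fun p hp => Polynomial.mem_degreeLT.2 hp

omit [DecidableEq Fq] in
lemma ncard_degree_lt (n : ℕ) :
    {p : Polynomial Fq | p.degree < n}.ncard = Fintype.card Fq ^ n := by
  have h : {p : Polynomial Fq | p.degree < n} = (Polynomial.degreeLT Fq n : Set _) := by
    ext p
    simp [Polynomial.mem_degreeLT]
  rw [h, ← Nat.card_coe_set_eq]
  change Nat.card (Polynomial.degreeLT Fq n) = _
  rw [Nat.card_congr (degreeLTEquiv Fq n).toEquiv]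
  simp

omit [DecidableEq Fq] in
lemma finite_polyVecLT (m n : ℕ) : (polyVecLT Fq m n).Finite := by
  have h := Set.Finite.pi (fun _ : Fin m => finite_degree_lt (Fq := Fq) n)
  refine h.subset fun a ha i _ => ha i

end Polynomials

section Measure

variable {Fq}

omit [Fintype Fq] [DecidableEq Fq] in
lemma isOpen_smallBall (k : ℤ) : IsOpen (smallBall Fq k : Set (Kinf Fq)) := by
  have hv : Valued.v (HahnSeries.single (k + 1) (1 : Fq) : Kinf Fq) =
      WithZero.exp (-(k + 1)) := LaurentSeries.valuation_single_zpow Fq (k + 1)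
  have h : (smallBall Fq k : Set (Kinf Fq)) = {x | Valued.v.restrict x ≤
      Valued.v.restrict (HahnSeries.single (k + 1) (1 : Fq) : Kinf Fq)} := by
    ext x
    rw [Set.mem_ofPred_eq, Valuation.restrict_le_iff, hv,
      LaurentSeries.valuation_le_iff_coeff_lt_eq_zero]
    simp only [SetLike.mem_coe, mem_smallBall, Int.lt_add_one_iff]
  rw [h]
  refine Valued.isOpen_closedBall _ ?_
  simp

variable [MeasurableSpace (Kinf Fq)] [BorelSpace (Kinf Fq)]

omit [Fintype Fq] [DecidableEq Fq] in
lemma measurableSet_fracCell (N : Polynomial Fq) (n : ℕ) (p : Polynomial Fq) :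
    MeasurableSet (fracCell N n p) :=
  ((isOpen_smallBall (Fq := Fq) n).preimage (continuous_sub_right _)).measurableSet

omit [Fintype Fq] [DecidableEq Fq] in
lemma measure_fracCell (ν : Measure (Kinf Fq)) [ν.IsAddLeftInvariant] (N : Polynomial Fq)
    (n : ℕ) (p : Polynomial Fq) : ν (fracCell N n p) = ν (smallBall Fq n) := by
  rw [← measure_preimage_add ν (-(emb Fq p / emb Fq N)) (smallBall Fq n)]
  congr 1
  ext x
  simp [fracCell, sub_eq_neg_add]

omit [DecidableEq Fq] in
lemma card_mul_measure_smallBall (ν : Measure (Kinf Fq)) [ν.IsAddLeftInvariant] (n : ℕ) :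
    (Fintype.card Fq : ℝ≥0∞) ^ n * ν (smallBall Fq n) = ν (mfrak Fq) := by
  have hN : (X ^ n : Polynomial Fq).degree = n := by simp
  set T := (finite_degree_lt (Fq := Fq) n).toFinset
  have hT : mfrak Fq = ⋃ p ∈ T, fracCell (X ^ n) n p := by
    ext x
    obtain ⟨p, hp⟩ := exists_mem_fracCell hN x
    simp only [Set.mem_iUnion, exists_prop, T, Set.Finite.mem_toFinset, Set.mem_ofPred_eq]
    exact ⟨fun hx => ⟨p, (mem_mfrak_iff_degree_lt hN hp).1 hx, hp⟩,
      fun ⟨p', h, hp'⟩ => (mem_mfrak_iff_degree_lt hN hp').2 h⟩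
  rw [hT, measure_biUnion_finset _ fun p _ => measurableSet_fracCell _ _ _]
  · simp only [measure_fracCell, Finset.sum_const, nsmul_eq_mul, T]
    rw [← Set.ncard_eq_toFinset_card _ (finite_degree_lt n), ncard_degree_lt, Nat.cast_pow]
  · exact fun p _ p' _ hne => Set.disjoint_left.2 fun x h h' => hne (eq_of_mem_fracCell hN h h')

end Measure

/-- Theorem 1.5: for every infinite set `S` of monic polynomials, every
`m`, `n`, every `N` of degree `n` and every `Q ∈ S`, the uniform probability that
`a ∈ R_{<n}^m` has `Q_{N,S}(a) = Q` equals `ν_m({α ∈ 𝔪^m : Q_{min,S}(α, q^{-n}) = Q})`. -/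
theorem stmt4 (S : Set (Polynomial Fq)) (hSinf : S.Infinite) (hSmonic : ∀ Q ∈ S, Q.Monic)
    [MeasurableSpace (Kinf Fq)] [BorelSpace (Kinf Fq)]
    (ν : Measure (Kinf Fq)) [SigmaFinite ν] [ν.IsAddLeftInvariant]
    (hν : ν (mfrak Fq) = 1)
    (m n : ℕ) (N : Polynomial Fq) (hN : N.degree = (n : WithBot ℕ))
    (Q : Polynomial Fq) (hQ : Q ∈ S) :
    (Set.ncard {a ∈ polyVecLT Fq m n | IsMinDenom Fq S m n (ratV Fq a N) Q} : ℝ≥0∞)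
        / (Fintype.card Fq : ℝ≥0∞) ^ (m * n)
      = Measure.pi (fun _ : Fin m => ν)
          {α ∈ mfrakV Fq m | IsMinDenom Fq S m n α Q} := by
  set T := {a ∈ polyVecLT Fq m n | IsMinDenom Fq S m n (ratV Fq a N) Q} with hTdef
  have hTfin : T.Finite := (finite_polyVecLT m n).subset fun a ha => ha.1
  let cell (a : Fin m → Polynomial Fq) : Set (Fin m → Kinf Fq) :=
    Set.univ.pi fun i => fracCell N n (a i)
  have hcell {a α} (h : α ∈ cell a) :
      (α ∈ mfrakV Fq m ∧ IsMinDenom Fq S m n α Q) ↔ a ∈ T := by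
    refine and_congr (forall_congr' fun i => mem_mfrak_iff_degree_lt hN (h i trivial)) ?_
    exact isMinDenom_congr fun i => h i trivial
  have hunion : {α ∈ mfrakV Fq m | IsMinDenom Fq S m n α Q} =
      ⋃ a ∈ hTfin.toFinset, cell a := by
    ext α
    choose a ha using fun i => exists_mem_fracCell hN (α i)
    have ha' : α ∈ cell a := fun i _ => ha i
    simp only [Set.mem_iUnion, exists_prop, Set.Finite.mem_toFinset]
    exact ⟨fun h => ⟨a, (hcell ha').1 h, ha'⟩, fun ⟨b, hb, hb'⟩ => (hcell hb').2 hb⟩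
  have hball := card_mul_measure_smallBall ν n
  rw [hν] at hball
  have hcard : (Fintype.card Fq : ℝ≥0∞) ^ n ≠ 0 := by simp
  have hinv : ν (smallBall Fq n) = ((Fintype.card Fq : ℝ≥0∞) ^ n)⁻¹ :=
    ENNReal.eq_inv_of_mul_eq_one_left (by rwa [mul_comm])
  rw [hunion, measure_biUnion_finset]
  · simp only [cell, Measure.pi_pi, measure_fracCell, Finset.prod_const, Finset.card_univ,
      Fintype.card_fin, Finset.sum_const, nsmul_eq_mul, hinv]
    rw [← Set.ncard_eq_toFinset_card _ hTfin, div_eq_mul_inv, ← ENNReal.inv_pow, ← pow_mul, mul_comm n m]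
  · exact fun a _ b _ hne => Set.disjoint_left.2 fun α h h' =>
      hne (funext fun i => eq_of_mem_fracCell hN (h i trivial) (h' i trivial))
  · exact fun a _ => MeasurableSet.univ_pi fun i => measurableSet_fracCell _ _ _
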